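/- Let S be a reflective numerical semigroup with genus g(S) = g ≥ 1 and multiplicity m(S) = a, and let q = ⌊g/a⌋ and r = g − q·a. Then the set of pseudo-Frobenius numbers of S is PF(S) = {g−(r−1), g−(r−2), ..., g−1} ∪ {2g−r}; in particular, the type of S is t(S) = r. -/

import Mathlib

/-- A numerical semigroup: a subset of ℕ containing 0, closed under addition,
with finite complement. -/
def IsNumericalSemigroup (S : Set ℕ) : Prop :=
  0 ∈ S ∧ (∀ a ∈ S, ∀ b ∈ S, a + b ∈ S) ∧ Sᶜ.Finite

/-- The genus: number of gaps. -/
noncomputable def genus (S : Set ℕ) : ℕ := Sᶜ.ncard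

/-- The Frobenius number: the largest gap. -/
noncomputable def frob (S : Set ℕ) : ℕ := sSup Sᶜ

/-- The multiplicity: the smallest positive element. -/
noncomputable def mult (S : Set ℕ) : ℕ := sInf {n ∈ S | 0 < n}

/-- A numerical semigroup is reflective if for each z ∈ {0,...,g-1}
exactly one of z and z + g lies in S, where g is the genus. -/
def Reflective (S : Set ℕ) : Prop :=
  ∀ z < genus S, Xor' (z ∈ S) (z + genus S ∈ S)

/-- A set A is equidistributed modulo m if each residue class mod m contains
the same number of elements of A. -/
def Equidistributed (A : Set ℕ) (m : ℕ) : Prop :=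
  ∀ r₁ < m, ∀ r₂ < m, {x ∈ A | x % m = r₁}.ncard = {x ∈ A | x % m = r₂}.ncard

/-- The submonoid of ℕ generated by A. -/
def gen (A : Set ℕ) : Set ℕ := (AddSubmonoid.closure A : Set ℕ)

/-- The (unique) minimal generating set of a numerical semigroup: nonzero elements
not expressible as a sum of two nonzero elements. -/
def minGens (S : Set ℕ) : Set ℕ :=
  {n ∈ S | n ≠ 0 ∧ ∀ a ∈ S, ∀ b ∈ S, a ≠ 0 → b ≠ 0 → n ≠ a + b}

/-- The embedding dimension: the cardinality of the minimal generating set. -/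
noncomputable def embdim (S : Set ℕ) : ℕ := (minGens S).ncard

/-- The Apéry set of S relative to t: elements s of S with s - t ∉ S. -/
def aperySet (S : Set ℕ) (t : ℕ) : Set ℕ := {s ∈ S | ∀ u ∈ S, s ≠ u + t}

/-- Pseudo-Frobenius numbers: gaps h such that h + s ∈ S for every nonzero s ∈ S. -/
def pseudoFrobenius (S : Set ℕ) : Set ℕ :=
  {h | h ∉ S ∧ ∀ s ∈ S, s ≠ 0 → h + s ∈ S}

/-- Membership of an integer in (the image in ℤ of) a numerical semigroup. -/
def memZ (S : Set ℕ) (z : ℤ) : Prop := 0 ≤ z ∧ z.toNat ∈ S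

/-- Symmetric numerical semigroup. -/
def IsSymmetricNS (S : Set ℕ) : Prop :=
  ∀ z : ℤ, Xor' (memZ S z) (memZ S ((frob S : ℤ) - z))

/-- Pseudo-symmetric numerical semigroup. -/
def IsPseudoSymmetricNS (S : Set ℕ) : Prop :=
  2 ∣ frob S ∧ ∀ z : ℤ, z ≠ (frob S : ℤ) / 2 →
    Xor' (memZ S z) (memZ S ((frob S : ℤ) - z))

/-- Irreducible numerical semigroup. -/
def IsIrreducibleNS (S : Set ℕ) : Prop :=
  ¬ ∃ T₁ T₂ : Set ℕ, IsNumericalSemigroup T₁ ∧ IsNumericalSemigroup T₂ ∧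
    S ⊂ T₁ ∧ S ⊂ T₂ ∧ S = T₁ ∩ T₂

/-- A telescopic sequence a₁,...,a_k (1-indexed) of positive integers. -/
def TelescopicSeq (a : ℕ → ℕ) (k : ℕ) : Prop :=
  (∀ i ∈ Finset.Icc 1 k, 0 < a i) ∧
  ∀ j ∈ Finset.Icc 2 k,
    ((Finset.Icc 1 (j-1)).gcd a / (Finset.Icc 1 j).gcd a) * a j ∈
      gen (a '' Set.Icc 1 (j-1))

/-- A free numerical semigroup: one generated by (the underlying set of)
a telescopic sequence. -/
def IsFreeNS (S : Set ℕ) : Prop :=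
  ∃ (k : ℕ) (a : ℕ → ℕ), TelescopicSeq a k ∧ S = gen (a '' Set.Icc 1 k)

theorem Reflective.mem_of_two_mul_genus_le {S : Set ℕ} (hfin : Sᶜ.Finite) (hrefl : Reflective S)
    {x : ℕ} (hx : 2 * genus S ≤ x) : x ∈ S := by
  classical
  by_contra hxS
  let f : ℕ → ℕ := fun z => if z ∈ S then z + genus S else z
  have hmem : ∀ z ∈ Finset.range (genus S), f z ∈ hfin.toFinset.erase x := by
    intro z hz
    rw [Finset.mem_range] at hz
    have h := hrefl z hz
    simp only [Finset.mem_erase, Set.Finite.mem_toFinset, Set.mem_compl_iff, f]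
    split_ifs with hzS
    · exact ⟨by omega, h.elim And.right fun h => absurd hzS h.2⟩
    · exact ⟨by omega, hzS⟩
  have hinj : Set.InjOn f (Finset.range (genus S)) := by
    intro y hy z hz hyz
    simp only [Finset.coe_range, Set.mem_Iio] at hy hz
    simp only [f] at hyz
    split_ifs at hyz <;> omega
  have hcard := Finset.card_le_card_of_injOn f hmem hinj
  have hxmem : x ∈ hfin.toFinset := by simpa using hxS
  have hpos := Finset.card_pos.mpr ⟨x, hxmem⟩
  have hg : genus S = hfin.toFinset.card := Set.ncard_eq_toFinset_card _ hfin
  rw [Finset.card_range, Finset.card_erase_of_mem hxmem] at hcard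
  omega

theorem IsNumericalSemigroup.mul_mem {S : Set ℕ} (hS : IsNumericalSemigroup S) {a : ℕ}
    (ha : a ∈ S) (k : ℕ) : k * a ∈ S := by
  induction k with
  | zero => simpa using hS.1
  | succ k ih => rw [Nat.succ_mul]; exact hS.2.1 _ ih _ ha

theorem IsNumericalSemigroup.mult_mem {S : Set ℕ} (hS : IsNumericalSemigroup S) :
    mult S ∈ S ∧ 0 < mult S := by
  have hne : {n ∈ S | 0 < n}.Nonempty := by
    obtain ⟨b, hb⟩ := hS.2.2.bddAbove
    refine ⟨b + 1, ?_, b.succ_pos⟩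
    by_contra h
    have := hb h
    omega
  exact Nat.sInf_mem hne

/-- Below the genus, a reflective semigroup consists of the multiples of its multiplicity. -/
theorem Reflective.mem_iff_dvd {S : Set ℕ} (hS : IsNumericalSemigroup S) (hrefl : Reflective S)
    {x : ℕ} (hx : x < genus S) : x ∈ S ↔ mult S ∣ x := by
  obtain ⟨haS, hapos⟩ := hS.mult_mem
  constructor
  · intro hxS
    have hdm := Nat.div_add_mod' x (mult S)
    have hlt := Nat.mod_lt x hapos
    have hmod : x % mult S ∈ S := by
      by_contra hn
      have h1 : x % mult S + genus S ∈ S :=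
        (hrefl _ ((Nat.mod_le _ _).trans_lt hx)).elim (fun h => absurd h.1 hn) And.left
      have h2 := hS.2.1 _ (hS.mul_mem haS (x / mult S)) _ h1
      rw [← add_assoc, hdm] at h2
      exact (hrefl x hx).elim (fun h => h.2 h2) (fun h => h.2 hxS)
    refine Nat.dvd_of_mod_eq_zero (Nat.eq_zero_of_not_pos fun hpos => ?_)
    exact absurd (Nat.sInf_le (s := {n ∈ S | 0 < n}) ⟨hmod, hpos⟩) (not_le.mpr hlt)
  · rintro ⟨k, rfl⟩
    rw [mul_comm]
    exact hS.mul_mem haS k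

/-- Between the genus and its double, a reflective semigroup omits exactly the translates by the
genus of the multiples of its multiplicity. -/
theorem Reflective.add_genus_mem_iff_not_dvd {S : Set ℕ} (hS : IsNumericalSemigroup S)
    (hrefl : Reflective S) {x : ℕ} (hx : x < genus S) :
    genus S + x ∈ S ↔ ¬ mult S ∣ x := by
  rw [← hrefl.mem_iff_dvd hS hx, add_comm]
  rcases hrefl x hx with h | h <;> tauto

theorem Reflective.pseudoFrobenius_eq {S : Set ℕ} (hS : IsNumericalSemigroup S)
    (hrefl : Reflective S) {q r : ℕ} (hg : genus S = q * mult S + r) (hr : 0 < r)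
    (hra : r < mult S) :
    pseudoFrobenius S = Set.Icc (genus S - (r - 1)) (genus S - 1) ∪ {2 * genus S - r} := by
  obtain ⟨haS, hapos⟩ := hS.mult_mem
  have hbig : ∀ x, 2 * genus S ≤ x → x ∈ S := fun x => hrefl.mem_of_two_mul_genus_le hS.2.2
  have hlow : ∀ x < genus S, (x ∈ S ↔ mult S ∣ x) := fun x => hrefl.mem_iff_dvd hS
  have hhigh : ∀ x < genus S, (genus S + x ∈ S ↔ ¬ mult S ∣ x) :=
    fun x => hrefl.add_genus_mem_iff_not_dvd hS
  generalize mult S = a at *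
  generalize genus S = g at *
  have hnd : ∀ k j, 0 < j → j < a → ¬ a ∣ k * a + j := by
    intro k j hj hja h
    exact absurd (Nat.le_of_dvd hj ((Nat.dvd_add_right (Dvd.intro_left k rfl)).mp h))
      (not_le.mpr hja)
  -- everything above `g + q * a` lies in `S`
  have htop : ∀ x, g + q * a < x → x ∈ S := by
    intro x hx
    rcases le_or_gt (2 * g) x with h | h
    · exact hbig x h
    · have := (hhigh (q * a + (x - g - q * a)) (by omega)).mpr (hnd _ _ (by omega) (by omega))
      rwa [show g + (q * a + (x - g - q * a)) = x by omega] at this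
  ext h
  simp only [pseudoFrobenius, Set.mem_ofPred_eq, Set.mem_union, Set.mem_Icc, Set.mem_singleton_iff]
  constructor
  · rintro ⟨hh, hpf⟩
    have hha := hpf a haS hapos.ne'
    rcases lt_or_ge h g with hlt | hge
    · left
      have hdvd := (not_congr (hlow h hlt)).mp hh
      rcases lt_or_ge (h + a) g with h1 | h1
      · exact absurd ((Nat.dvd_add_left dvd_rfl).mp ((hlow _ h1).mp hha)) hdvd
      have hne : h ≠ q * a := fun e => hdvd (e ▸ Dvd.intro_left q rfl)
      by_contra hcon
      have h2 : h < q * a := by omega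
      have hne' : h + a ≠ g := by
        intro e
        have := (hhigh 0 (by omega)).mp (by rwa [add_zero, ← e])
        exact this (dvd_zero a)
      -- the element of `S` that sends `h` to the largest gap
      have hs : g + (q * a - h) ∈ S := by
        refine (hhigh _ (by omega)).mpr fun hd => hdvd ?_
        exact (Nat.dvd_sub_iff_right h2.le (Dvd.intro_left q rfl)).mp hd
      have h3 := hpf _ hs (by omega)
      rw [show h + (g + (q * a - h)) = g + q * a by omega] at h3
      exact (hhigh (q * a) (by omega)).mp h3 (Dvd.intro_left q rfl)
    · right
      have h2g : h < 2 * g := lt_of_not_ge fun h' => hh (hbig h h')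
      obtain ⟨y, rfl⟩ := Nat.exists_eq_add_of_le hge
      have hdvd : a ∣ y := not_not.mp ((not_congr (hhigh y (by omega))).mp hh)
      by_contra hne
      have h1 : g + q * a ≥ g + y := le_of_not_gt fun h' => hh (htop _ h')
      have h2 : a ≤ q * a - y :=
        Nat.le_of_dvd (by omega) (Nat.dvd_sub (Dvd.intro_left q rfl) hdvd)
      rw [add_assoc] at hha
      exact (hhigh (y + a) (by omega)).mp hha (hdvd.add dvd_rfl)
  · rintro (⟨h1, h2⟩ | rfl)
    · have hgap : h ∉ S := by
        rw [hlow h (by omega), show h = q * a + (h - q * a) by omega]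
        exact hnd _ _ (by omega) (by omega)
      refine ⟨hgap, fun s hs hs0 => ?_⟩
      rcases lt_or_ge s g with hsg | hsg
      · obtain ⟨k, rfl⟩ := (hlow s hsg).mp hs
        obtain ⟨k, rfl⟩ := Nat.exists_eq_succ_of_ne_zero (right_ne_zero_of_mul hs0)
        have e : a * k.succ = k * a + a := by rw [Nat.mul_succ, mul_comm]
        rw [e] at hsg ⊢
        have := (hhigh (k * a + (h + a - g)) (by omega)).mpr (hnd _ _ (by omega) (by omega))
        rwa [show g + (k * a + (h + a - g)) = h + (k * a + a) by omega] at this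
      · exact htop _ (by omega)
    · rw [show 2 * g - r = g + q * a by omega]
      refine ⟨fun h => (hhigh (q * a) (by omega)).mp h (Dvd.intro_left q rfl), fun s _ hs0 => ?_⟩
      exact htop _ (by omega)

theorem stmt10 (S : Set ℕ) (hS : IsNumericalSemigroup S) (hrefl : Reflective S)
    (g a q r : ℕ) (hg : genus S = g) (hg1 : 1 ≤ g) (ha : mult S = a)
    (hq : q = g / a) (hr : r = g - q * a) :
    pseudoFrobenius S = Set.Icc (g - (r - 1)) (g - 1) ∪ {2 * g - r} ∧
    (pseudoFrobenius S).ncard = r := by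
  obtain ⟨haS, hapos⟩ := hS.mult_mem
  subst hg ha
  have hdm := Nat.div_add_mod' (genus S) (mult S)
  have hlt := Nat.mod_lt (genus S) hapos
  rw [← hq] at hdm
  have hgS : genus S ∉ S := fun h =>
    (hrefl.add_genus_mem_iff_not_dvd hS hg1).mp h (dvd_zero _)
  have hr0 : r ≠ 0 := by
    intro h0
    apply hgS
    rw [show genus S = q * mult S by omega]
    exact hS.mul_mem haS q
  have hpf := hrefl.pseudoFrobenius_eq hS (q := q) (r := r) (by omega) (by omega) (by omega)
  refine ⟨hpf, ?_⟩
  have hnot : 2 * genus S - r ∉ Set.Icc (genus S - (r - 1)) (genus S - 1) := by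
    rw [Set.mem_Icc]
    omega
  rw [hpf, Set.union_singleton, Set.ncard_insert_of_notMem hnot (Set.finite_Icc _ _),
    ← Finset.coe_Icc, Set.ncard_coe_finset, Nat.card_Icc]
  omega
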